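/- arXiv:2104.02141 — 4 statements merged into one kernel-verified Lean document; each statement's English description precedes it below -/
import Mathlib

section
/- Let Ξ = (E,F,G) and Ξ̃ = (Ẽ,F̃,G̃) be DACSs with dimensions (l,n,m) on X and X̃ respectively, with rank E(x) = r constant on a neighborhood U of x_p ∈ X and rank Ẽ(x̃) = r constant on a neighborhood Ũ of x̃_p ∈ X̃. If Ξ and Ξ̃ are locally ex-fb-equivalent at x_p and x̃_p, then any ODE control system Σ = (f,g^u,g^v,h,l^u) in the explicitation class Expl(Ξ) and any Σ̃ = (f̃,g̃^u,g̃^v,h̃,l̃^u) in Expl(Ξ̃) are locally sys-fb-equivalent at x_p and x̃_p. -/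
open Matrix Set

/-- Stack an `r × n'` matrix on top of a `p × n'` matrix (`r + p = l`). -/
def stackM {r p l : ℕ} (hl : r + p = l) {n' : Type*} (A : Matrix (Fin r) n' ℝ)
    (B : Matrix (Fin p) n' ℝ) : Matrix (Fin l) n' ℝ :=
  (Matrix.fromRows A B).submatrix (fun i => finSumFinEquiv.symm (Fin.cast hl.symm i)) id

/-- Stack a vector of `ℝʳ` on top of a vector of `ℝᵖ` (`r + p = l`). -/
def stackV {r p l : ℕ} (hl : r + p = l) (a : Fin r → ℝ) (b : Fin p → ℝ) : Fin l → ℝ :=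
  fun i => Sum.elim a b (finSumFinEquiv.symm (Fin.cast hl.symm i))

/-- `Σ = (f,g^u,g^v,h,l^u)` belongs to the explicitation class `Expl(Ξ)` of the DACS
`Ξ = (E,F,G)` on `X`. -/
def MemExpl (l n m r s p : ℕ) (hl : r + p = l)
    (X : Set (Fin n → ℝ))
    (E : (Fin n → ℝ) → Matrix (Fin l) (Fin n) ℝ)
    (F : (Fin n → ℝ) → Fin l → ℝ)
    (G : (Fin n → ℝ) → Matrix (Fin l) (Fin m) ℝ)
    (f : (Fin n → ℝ) → Fin n → ℝ)
    (gu : (Fin n → ℝ) → Matrix (Fin n) (Fin m) ℝ)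
    (gv : (Fin n → ℝ) → Matrix (Fin n) (Fin s) ℝ)
    (h : (Fin n → ℝ) → Fin p → ℝ)
    (lu : (Fin n → ℝ) → Matrix (Fin p) (Fin m) ℝ) : Prop :=
  ∃ (Q : (Fin n → ℝ) → Matrix (Fin l) (Fin l) ℝ)
    (E₁ : (Fin n → ℝ) → Matrix (Fin r) (Fin n) ℝ)
    (E₁d : (Fin n → ℝ) → Matrix (Fin n) (Fin r) ℝ)
    (F₁ : (Fin n → ℝ) → Fin r → ℝ)
    (G₁ : (Fin n → ℝ) → Matrix (Fin r) (Fin m) ℝ),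
    (∀ i j, ContDiffOn ℝ (⊤ : ℕ∞) (fun x => Q x i j) X) ∧
    (∀ x ∈ X, IsUnit (Q x)) ∧
    (∀ i j, ContDiffOn ℝ (⊤ : ℕ∞) (fun x => E₁d x i j) X) ∧
    (∀ i j, ContDiffOn ℝ (⊤ : ℕ∞) (fun x => gv x i j) X) ∧
    (∀ x ∈ X, Q x * E x = stackM hl (E₁ x) 0) ∧
    (∀ x ∈ X, (Q x).mulVec (F x) = stackV hl (F₁ x) (h x)) ∧
    (∀ x ∈ X, Q x * G x = stackM hl (G₁ x) (lu x)) ∧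
    (∀ x ∈ X, Function.Surjective (E₁ x).mulVecLin) ∧
    (∀ x ∈ X, E₁ x * E₁d x = 1) ∧
    (∀ x ∈ X, LinearMap.range (gv x).mulVecLin = LinearMap.ker (E₁ x).mulVecLin) ∧
    (∀ x ∈ X, f x = (E₁d x).mulVec (F₁ x)) ∧
    (∀ x ∈ X, gu x = E₁d x * G₁ x)

/-- Local external feedback equivalence of the DACSs `Ξ = (E,F,G)` on `X` and
`Ξ̃ = (Ẽ,F̃,G̃)` on `X̃`, at the points `x_p` and `x̃_p`. -/
def LocallyExFbEquiv (l n m : ℕ)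
    (X Xt : Set (Fin n → ℝ))
    (E Et : (Fin n → ℝ) → Matrix (Fin l) (Fin n) ℝ)
    (F Ft : (Fin n → ℝ) → Fin l → ℝ)
    (G Gt : (Fin n → ℝ) → Matrix (Fin l) (Fin m) ℝ)
    (xp xtp : Fin n → ℝ) : Prop :=
  ∃ (U Ut : Set (Fin n → ℝ)) (ψ ψinv : (Fin n → ℝ) → (Fin n → ℝ))
    (Dψ : (Fin n → ℝ) → Matrix (Fin n) (Fin n) ℝ)
    (Q : (Fin n → ℝ) → Matrix (Fin l) (Fin l) ℝ)
    (α : (Fin n → ℝ) → Fin m → ℝ)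
    (β : (Fin n → ℝ) → Matrix (Fin m) (Fin m) ℝ),
    IsOpen U ∧ IsOpen Ut ∧ xp ∈ U ∧ xtp ∈ Ut ∧ U ⊆ X ∧ Ut ⊆ Xt ∧
    ψ xp = xtp ∧ MapsTo ψ U Ut ∧ MapsTo ψinv Ut U ∧
    (∀ x ∈ U, ψinv (ψ x) = x) ∧ (∀ y ∈ Ut, ψ (ψinv y) = y) ∧
    ContDiffOn ℝ (⊤ : ℕ∞) ψ U ∧ ContDiffOn ℝ (⊤ : ℕ∞) ψinv Ut ∧
    (∀ x ∈ U, HasFDerivAt ψ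
      (LinearMap.toContinuousLinearMap (Matrix.mulVecLin (Dψ x))) x) ∧
    (∀ x ∈ U, IsUnit (Dψ x)) ∧
    (∀ i j, ContDiffOn ℝ (⊤ : ℕ∞) (fun x => Q x i j) U) ∧
    ContDiffOn ℝ (⊤ : ℕ∞) α U ∧
    (∀ i j, ContDiffOn ℝ (⊤ : ℕ∞) (fun x => β x i j) U) ∧
    (∀ x ∈ U, IsUnit (Q x)) ∧ (∀ x ∈ U, IsUnit (β x)) ∧
    (∀ x ∈ U, Et (ψ x) = Q x * E x * (Dψ x)⁻¹) ∧
    (∀ x ∈ U, Ft (ψ x) = (Q x).mulVec (F x + (G x).mulVec (α x))) ∧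
    (∀ x ∈ U, Gt (ψ x) = Q x * G x * β x)

/-- Local system feedback equivalence of the ODE control systems
`Σ = (f,g^u,g^v,h,l^u)` on `X` and `Σ̃ = (f̃,g̃^u,g̃^v,h̃,l̃^u)` on `X̃`, at the points
`x_p` and `x̃_p`. -/
def LocallySysFbEquiv (n m s p : ℕ)
    (X Xt : Set (Fin n → ℝ))
    (f ft : (Fin n → ℝ) → Fin n → ℝ)
    (gu gut : (Fin n → ℝ) → Matrix (Fin n) (Fin m) ℝ)
    (gv gvt : (Fin n → ℝ) → Matrix (Fin n) (Fin s) ℝ)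
    (h ht : (Fin n → ℝ) → Fin p → ℝ)
    (lu lut : (Fin n → ℝ) → Matrix (Fin p) (Fin m) ℝ)
    (xp xtp : Fin n → ℝ) : Prop :=
  ∃ (U Ut : Set (Fin n → ℝ)) (ψ ψinv : (Fin n → ℝ) → (Fin n → ℝ))
    (Dψ : (Fin n → ℝ) → Matrix (Fin n) (Fin n) ℝ)
    (αu : (Fin n → ℝ) → Fin m → ℝ)
    (αv : (Fin n → ℝ) → Fin s → ℝ)
    (lam : (Fin n → ℝ) → Matrix (Fin s) (Fin m) ℝ)
    (γ : (Fin n → ℝ) → Matrix (Fin n) (Fin p) ℝ)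
    (βu : (Fin n → ℝ) → Matrix (Fin m) (Fin m) ℝ)
    (βv : (Fin n → ℝ) → Matrix (Fin s) (Fin s) ℝ)
    (η : (Fin n → ℝ) → Matrix (Fin p) (Fin p) ℝ),
    IsOpen U ∧ IsOpen Ut ∧ xp ∈ U ∧ xtp ∈ Ut ∧ U ⊆ X ∧ Ut ⊆ Xt ∧
    ψ xp = xtp ∧ MapsTo ψ U Ut ∧ MapsTo ψinv Ut U ∧
    (∀ x ∈ U, ψinv (ψ x) = x) ∧ (∀ y ∈ Ut, ψ (ψinv y) = y) ∧
    ContDiffOn ℝ (⊤ : ℕ∞) ψ U ∧ ContDiffOn ℝ (⊤ : ℕ∞) ψinv Ut ∧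
    (∀ x ∈ U, HasFDerivAt ψ
      (LinearMap.toContinuousLinearMap (Matrix.mulVecLin (Dψ x))) x) ∧
    (∀ x ∈ U, IsUnit (Dψ x)) ∧
    ContDiffOn ℝ (⊤ : ℕ∞) αu U ∧ ContDiffOn ℝ (⊤ : ℕ∞) αv U ∧
    (∀ i j, ContDiffOn ℝ (⊤ : ℕ∞) (fun x => lam x i j) U) ∧
    (∀ i j, ContDiffOn ℝ (⊤ : ℕ∞) (fun x => γ x i j) U) ∧
    (∀ i j, ContDiffOn ℝ (⊤ : ℕ∞) (fun x => βu x i j) U) ∧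
    (∀ i j, ContDiffOn ℝ (⊤ : ℕ∞) (fun x => βv x i j) U) ∧
    (∀ i j, ContDiffOn ℝ (⊤ : ℕ∞) (fun x => η x i j) U) ∧
    (∀ x ∈ U, IsUnit (βu x)) ∧ (∀ x ∈ U, IsUnit (βv x)) ∧ (∀ x ∈ U, IsUnit (η x)) ∧
    (∀ x ∈ U, ft (ψ x) = (Dψ x).mulVec
      (f x + (gu x).mulVec (αu x) + (gv x).mulVec (αv x + (lam x).mulVec (αu x))
        + (γ x).mulVec (h x + (lu x).mulVec (αu x)))) ∧
    (∀ x ∈ U, gut (ψ x) =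
      Dψ x * (gu x * βu x + gv x * (lam x * βu x) + γ x * (lu x * βu x))) ∧
    (∀ x ∈ U, gvt (ψ x) = Dψ x * (gv x * βv x)) ∧
    (∀ x ∈ U, ht (ψ x) = (η x).mulVec (h x + (lu x).mulVec (αu x))) ∧
    (∀ x ∈ U, lut (ψ x) = η x * (lu x * βu x))

/-- A matrix-valued map is smooth on a set when all its entries are. -/
def SmoothMatOn {V ι κ : Type*} [NormedAddCommGroup V] [NormedSpace ℝ V]
    (A : V → Matrix ι κ ℝ) (U : Set V) : Prop :=
  ∀ i j, ContDiffOn ℝ (⊤ : ℕ∞) (fun x => A x i j) U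

namespace SmoothMatOn

variable {V ι κ τ : Type*} [NormedAddCommGroup V] [NormedSpace ℝ V] {U : Set V}

theorem mul [Fintype κ] {A : V → Matrix ι κ ℝ} {B : V → Matrix κ τ ℝ}
    (hA : SmoothMatOn A U) (hB : SmoothMatOn B U) :
    SmoothMatOn (fun x => A x * B x) U := fun i j => by
  simp only [Matrix.mul_apply]
  exact ContDiffOn.sum fun k _ => (hA i k).mul (hB k j)

theorem sub {A B : V → Matrix ι κ ℝ} (hA : SmoothMatOn A U) (hB : SmoothMatOn B U) :
    SmoothMatOn (fun x => A x - B x) U := fun i j => (hA i j).sub (hB i j)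

theorem transpose {A : V → Matrix ι κ ℝ} (hA : SmoothMatOn A U) :
    SmoothMatOn (fun x => (A x)ᵀ) U := fun i j => hA j i

theorem mulVec [Fintype ι] [Fintype κ] {A : V → Matrix ι κ ℝ} {b : V → κ → ℝ}
    (hA : SmoothMatOn A U) (hb : ContDiffOn ℝ (⊤ : ℕ∞) b U) :
    ContDiffOn ℝ (⊤ : ℕ∞) (fun x => (A x).mulVec (b x)) U := by
  refine contDiffOn_pi.2 fun i => ?_
  simp only [Matrix.mulVec, dotProduct]
  exact ContDiffOn.sum fun k _ => (hA i k).mul (contDiffOn_pi.1 hb k)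

theorem det [Fintype ι] [DecidableEq ι] {A : V → Matrix ι ι ℝ} (hA : SmoothMatOn A U) :
    ContDiffOn ℝ (⊤ : ℕ∞) (fun x => (A x).det) U := by
  simp only [Matrix.det_apply']
  exact ContDiffOn.sum fun σ _ => contDiffOn_const.mul (contDiffOn_prod fun i _ => hA _ _)

theorem adjugate [Fintype ι] [DecidableEq ι] {A : V → Matrix ι ι ℝ} (hA : SmoothMatOn A U) :
    SmoothMatOn (fun x => (A x).adjugate) U := fun i j => by
  simp only [Matrix.adjugate_apply]
  refine SmoothMatOn.det fun a b => ?_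
  rcases eq_or_ne a j with rfl | ha
  · simpa only [Matrix.updateRow_self] using contDiffOn_const
  · simpa only [Matrix.updateRow_ne ha] using hA a b

theorem inv [Fintype ι] [DecidableEq ι] {A : V → Matrix ι ι ℝ} (hA : SmoothMatOn A U)
    (hu : ∀ x ∈ U, IsUnit (A x)) : SmoothMatOn (fun x => (A x)⁻¹) U := fun i j => by
  simp only [Matrix.inv_def, Ring.inverse_eq_inv', Matrix.smul_apply, smul_eq_mul]
  exact (hA.det.inv fun x hx => ((Matrix.isUnit_iff_isUnit_det _).1 (hu x hx)).ne_zero).mul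
    (hA.adjugate i j)

theorem comp {W : Type*} [NormedAddCommGroup W] [NormedSpace ℝ W] {S : Set W}
    {A : W → Matrix ι κ ℝ} {φ : V → W} (hA : SmoothMatOn A S)
    (hφ : ContDiffOn ℝ (⊤ : ℕ∞) φ U) (hm : MapsTo φ U S) :
    SmoothMatOn (fun x => A (φ x)) U := fun i j => (hA i j).comp hφ hm

theorem mono {A : V → Matrix ι κ ℝ} {S : Set V} (hA : SmoothMatOn A S) (hU : U ⊆ S) :
    SmoothMatOn A U := fun i j => (hA i j).mono hU

end SmoothMatOn

/-- The Jacobian matrix of a smooth map is smooth. -/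
theorem smoothMatOn_of_hasFDerivAt {ι κ : Type*} [Fintype ι] [Fintype κ] [DecidableEq κ]
    {U : Set (κ → ℝ)} (hU : IsOpen U) {φ : (κ → ℝ) → ι → ℝ} {J : (κ → ℝ) → Matrix ι κ ℝ}
    (hφ : ContDiffOn ℝ (⊤ : ℕ∞) φ U)
    (hJ : ∀ x ∈ U, HasFDerivAt φ
      (LinearMap.toContinuousLinearMap (Matrix.mulVecLin (J x))) x) :
    SmoothMatOn J U := fun i j => by
  have h1 : ContDiffOn ℝ (⊤ : ℕ∞) (fderiv ℝ φ) U := hφ.fderiv_of_isOpen hU (by simp)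
  have h2 := contDiffOn_pi.1
    (h1.clm_apply (contDiffOn_const (c := (Pi.single j 1 : κ → ℝ)))) i
  refine h2.congr fun x hx => ?_
  simp [(hJ x hx).fderiv]

/-- The equivalence of index types underlying `stackM` and `stackV`. -/
def stackEquiv {r p l : ℕ} (hl : r + p = l) : Fin r ⊕ Fin p ≃ Fin l :=
  finSumFinEquiv.trans (finCongr hl)

theorem stackM_eq_submatrix {r p l : ℕ} (hl : r + p = l) {κ : Type*}
    (A : Matrix (Fin r) κ ℝ) (B : Matrix (Fin p) κ ℝ) :
    stackM hl A B = (Matrix.fromRows A B).submatrix (stackEquiv hl).symm id := rfl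

theorem stackV_eq_comp {r p l : ℕ} (hl : r + p = l) (a : Fin r → ℝ) (b : Fin p → ℝ) :
    stackV hl a b = Sum.elim a b ∘ (stackEquiv hl).symm := rfl

theorem stackM_apply_inl {r p l : ℕ} (hl : r + p = l) {κ : Type*}
    (A : Matrix (Fin r) κ ℝ) (B : Matrix (Fin p) κ ℝ) (i : Fin r) (j : κ) :
    stackM hl A B (stackEquiv hl (Sum.inl i)) j = A i j := by
  simp [stackM_eq_submatrix]

theorem stackV_apply_inl {r p l : ℕ} (hl : r + p = l) (a : Fin r → ℝ) (b : Fin p → ℝ)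
    (i : Fin r) : stackV hl a b (stackEquiv hl (Sum.inl i)) = a i := by
  simp [stackV_eq_comp]

theorem blocks_of_mul_stackM {r p l : ℕ} (hl : r + p = l) {κ : Type*}
    {T : Matrix (Fin l) (Fin l) ℝ} {A C : Matrix (Fin r) κ ℝ} {B D : Matrix (Fin p) κ ℝ}
    (hT : T * stackM hl A B = stackM hl C D) :
    let T' := T.submatrix (stackEquiv hl) (stackEquiv hl)
    T'.toBlocks₁₁ * A + T'.toBlocks₁₂ * B = C ∧
      T'.toBlocks₂₁ * A + T'.toBlocks₂₂ * B = D := by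
  intro T'
  have h1 : T' * Matrix.fromRows A B = Matrix.fromRows C D := by
    have h2 := congrArg (fun M => M.submatrix (stackEquiv hl) id) hT
    simp only [stackM_eq_submatrix, ← Matrix.submatrix_mul_equiv _ _ _ (stackEquiv hl) id,
      Matrix.submatrix_submatrix, Equiv.symm_comp_self, Function.comp_id,
      Matrix.submatrix_id_id] at h2
    exact h2
  rw [← Matrix.fromBlocks_toBlocks T', Matrix.fromBlocks_mul_fromRows] at h1
  exact Matrix.fromRows_inj h1

theorem blocks_of_mulVec_stackV {r p l : ℕ} (hl : r + p = l)
    {T : Matrix (Fin l) (Fin l) ℝ} {a c : Fin r → ℝ} {b d : Fin p → ℝ}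
    (hT : T.mulVec (stackV hl a b) = stackV hl c d) :
    let T' := T.submatrix (stackEquiv hl) (stackEquiv hl)
    T'.toBlocks₁₁.mulVec a + T'.toBlocks₁₂.mulVec b = c ∧
      T'.toBlocks₂₁.mulVec a + T'.toBlocks₂₂.mulVec b = d := by
  intro T'
  have h1 : T'.mulVec (Sum.elim a b) = Sum.elim c d := by
    rw [Matrix.submatrix_mulVec_equiv, ← stackV_eq_comp, hT, stackV_eq_comp,
      Function.comp_assoc, Equiv.symm_comp_self, Function.comp_id]
  rw [← Matrix.fromBlocks_toBlocks T', Matrix.fromBlocks_mulVec] at h1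
  exact ⟨by simpa using congrArg (fun v => v ∘ Sum.inl) h1,
    by simpa using congrArg (fun v => v ∘ Sum.inr) h1⟩

theorem stackV_add_stackM_mulVec {r p l : ℕ} (hl : r + p = l) {κ : Type*} [Fintype κ]
    (a : Fin r → ℝ) (b : Fin p → ℝ) (A : Matrix (Fin r) κ ℝ) (B : Matrix (Fin p) κ ℝ)
    (v : κ → ℝ) :
    stackV hl a b + (stackM hl A B).mulVec v = stackV hl (a + A.mulVec v) (b + B.mulVec v) := by
  ext i
  simp only [stackV, stackM, Pi.add_apply, Matrix.mulVec, Matrix.submatrix_apply, id]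
  rcases finSumFinEquiv.symm (Fin.cast hl.symm i) with k | k <;> rfl

theorem stackM_mul {r p l : ℕ} (hl : r + p = l) {κ τ : Type*} [Fintype κ]
    (A : Matrix (Fin r) κ ℝ) (B : Matrix (Fin p) κ ℝ) (C : Matrix κ τ ℝ) :
    stackM hl A B * C = stackM hl (A * C) (B * C) := by
  ext i j
  simp only [stackM, Matrix.mul_apply, Matrix.submatrix_apply, id]
  rcases finSumFinEquiv.symm (Fin.cast hl.symm i) with k | k <;> rfl

/-- If the columns of `N` lie in `ker A = im K` and `L` is a left inverse of `K`,
then `K * L` fixes `N`. -/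
theorem mul_mul_eq_of_range_eq_ker {ι κ σ τ : Type*} [Fintype κ] [Fintype σ] [DecidableEq σ]
    [Fintype τ] [DecidableEq τ]
    {A : Matrix ι κ ℝ} {K : Matrix κ σ ℝ} {L : Matrix σ κ ℝ} {N : Matrix κ τ ℝ}
    (hr : LinearMap.range K.mulVecLin = LinearMap.ker A.mulVecLin) (hL : L * K = 1)
    (hN : A * N = 0) : K * (L * N) = N := by
  refine Matrix.ext_of_mulVec_single fun j => ?_
  have hmem : N.mulVec (Pi.single j 1) ∈ LinearMap.range K.mulVecLin := by
    rw [hr, LinearMap.mem_ker, Matrix.mulVecLin_apply, Matrix.mulVec_mulVec, hN,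
      Matrix.zero_mulVec]
  obtain ⟨w, hw⟩ := hmem
  rw [Matrix.mulVecLin_apply] at hw
  rw [← Matrix.mulVec_mulVec, ← Matrix.mulVec_mulVec, ← hw, Matrix.mulVec_mulVec w L, hL,
    Matrix.one_mulVec]

theorem mul_eq_zero_of_range_eq_ker {ι κ σ : Type*} [Fintype κ] [Fintype σ] [DecidableEq σ]
    {A : Matrix ι κ ℝ} {K : Matrix κ σ ℝ}
    (hr : LinearMap.range K.mulVecLin = LinearMap.ker A.mulVecLin) : A * K = 0 := by
  refine Matrix.ext_of_mulVec_single fun j => ?_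
  have hmem : K.mulVecLin (Pi.single j 1) ∈ LinearMap.ker A.mulVecLin :=
    hr ▸ LinearMap.mem_range_self _ _
  rw [← Matrix.mulVec_mulVec, Matrix.zero_mulVec]
  exact hmem

theorem mulVec_injective_of_range_eq_ker {n r s : ℕ} (hn : r + s = n)
    {A : Matrix (Fin r) (Fin n) ℝ} {K : Matrix (Fin n) (Fin s) ℝ}
    (hs : Function.Surjective A.mulVecLin)
    (hr : LinearMap.range K.mulVecLin = LinearMap.ker A.mulVecLin) :
    Function.Injective K.mulVec := by
  have h1 := A.mulVecLin.finrank_range_add_finrank_ker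
  have h2 := K.mulVecLin.finrank_range_add_finrank_ker
  rw [LinearMap.range_eq_top.2 hs, finrank_top] at h1
  rw [hr] at h2
  simp only [Module.finrank_fin_fun] at h1 h2
  have h3 : Module.finrank ℝ (LinearMap.ker K.mulVecLin) = 0 := by omega
  exact LinearMap.ker_eq_bot.1 (Submodule.finrank_eq_zero.1 h3)

theorem isUnit_transpose_mul_self {ι κ : Type*} [Fintype ι] [Fintype κ] [DecidableEq κ]
    {K : Matrix ι κ ℝ} (hK : Function.Injective K.mulVec) : IsUnit (Kᵀ * K) := by
  rw [← Matrix.mulVec_injective_iff_isUnit]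
  have h1 : LinearMap.ker (Kᵀ * K).mulVecLin = ⊥ := by
    rw [Matrix.ker_mulVecLin_transpose_mul_self]
    exact LinearMap.ker_eq_bot.2 hK
  exact LinearMap.ker_eq_bot.1 h1

/-- If the DACSs `Ξ` and `Ξ̃` (with constant rank `r` of `E`, `Ẽ` near
`x_p`, `x̃_p`) are locally ex-fb-equivalent, then any explicitations
`Σ ∈ Expl(Ξ)` and `Σ̃ ∈ Expl(Ξ̃)` are locally sys-fb-equivalent. -/
theorem stmt_1 {l n m r s p : ℕ} (hl : r + p = l) (hn : r + s = n)
    (X Xt : Set (Fin n → ℝ)) (hXo : IsOpen X) (hXto : IsOpen Xt)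
    (xp xtp : Fin n → ℝ) (hxp : xp ∈ X) (hxtp : xtp ∈ Xt)
    (E Et : (Fin n → ℝ) → Matrix (Fin l) (Fin n) ℝ)
    (F Ft : (Fin n → ℝ) → Fin l → ℝ)
    (G Gt : (Fin n → ℝ) → Matrix (Fin l) (Fin m) ℝ)
    (hE : ∀ i j, ContDiffOn ℝ (⊤ : ℕ∞) (fun x => E x i j) X)
    (hF : ContDiffOn ℝ (⊤ : ℕ∞) F X)
    (hG : ∀ i j, ContDiffOn ℝ (⊤ : ℕ∞) (fun x => G x i j) X)
    (hEt : ∀ i j, ContDiffOn ℝ (⊤ : ℕ∞) (fun x => Et x i j) Xt)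
    (hFt : ContDiffOn ℝ (⊤ : ℕ∞) Ft Xt)
    (hGt : ∀ i j, ContDiffOn ℝ (⊤ : ℕ∞) (fun x => Gt x i j) Xt)
    (hrE : ∀ x ∈ X, (E x).rank = r)
    (hrEt : ∀ x ∈ Xt, (Et x).rank = r)
    (f ft : (Fin n → ℝ) → Fin n → ℝ)
    (gu gut : (Fin n → ℝ) → Matrix (Fin n) (Fin m) ℝ)
    (gv gvt : (Fin n → ℝ) → Matrix (Fin n) (Fin s) ℝ)
    (h ht : (Fin n → ℝ) → Fin p → ℝ)
    (lu lut : (Fin n → ℝ) → Matrix (Fin p) (Fin m) ℝ)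
    (hSigma : MemExpl l n m r s p hl X E F G f gu gv h lu)
    (hSigmat : MemExpl l n m r s p hl Xt Et Ft Gt ft gut gvt ht lut)
    (hequiv : LocallyExFbEquiv l n m X Xt E Et F Ft G Gt xp xtp) :
    LocallySysFbEquiv n m s p X Xt f ft gu gut gv gvt h ht lu lut xp xtp := by
  obtain ⟨Q₁, E₁, E₁d, F₁, G₁, hQ₁, hQ₁u, hE₁d, hgv, hQE, hQF, hQG, hE₁s, hE₁E, hgvr, hf, hgu⟩ :=
    hSigma
  obtain ⟨Q₂, E₂, E₂d, F₂, G₂, hQ₂, hQ₂u, hE₂d, hgvt, hQEt, hQFt, hQGt, hE₂s, hE₂E, hgvtr, hft,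
    hgut⟩ := hSigmat
  obtain ⟨U, Ut, ψ, ψinv, J, Q, α, β, hU, hUt, hxU, hxUt, hUX, hUtX, hψp, hψm, hψim, hψl, hψr,
    hψ, hψi, hJ, hJu, hQ, hα, hβ, hQu, hβu, hEψ, hFψ, hGψ⟩ := hequiv
  have hψX : MapsTo ψ U Xt := fun x hx => hUtX (hψm hx)
  have hJs : SmoothMatOn J U := smoothMatOn_of_hasFDerivAt hU hψ hJ
  have hJis : SmoothMatOn (fun x => (J x)⁻¹) U := hJs.inv hJu
  have hJJi : ∀ x ∈ U, J x * (J x)⁻¹ = 1 := fun x hx =>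
    Matrix.mul_nonsing_inv _ ((Matrix.isUnit_iff_isUnit_det _).1 (hJu x hx))
  have hJiJ : ∀ x ∈ U, (J x)⁻¹ * J x = 1 := fun x hx =>
    Matrix.nonsing_inv_mul _ ((Matrix.isUnit_iff_isUnit_det _).1 (hJu x hx))
  have hQ₁i : ∀ x ∈ U, (Q₁ x)⁻¹ * Q₁ x = 1 := fun x hx =>
    Matrix.nonsing_inv_mul _ ((Matrix.isUnit_iff_isUnit_det _).1 (hQ₁u x (hUX hx)))
  have hgvs : SmoothMatOn gv U := SmoothMatOn.mono hgv hUX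
  have hgvu : ∀ x ∈ U, IsUnit ((gv x)ᵀ * gv x) := fun x hx => isUnit_transpose_mul_self
    (mulVec_injective_of_range_eq_ker hn (hE₁s x (hUX hx)) (hgvr x (hUX hx)))
  -- a smooth left inverse of `gv`
  obtain ⟨L, hLs, hL⟩ : ∃ L : (Fin n → ℝ) → Matrix (Fin s) (Fin n) ℝ,
      SmoothMatOn L U ∧ ∀ x ∈ U, L x * gv x = 1 :=
    ⟨fun x => ((gv x)ᵀ * gv x)⁻¹ * (gv x)ᵀ,
      ((hgvs.transpose.mul hgvs).inv hgvu).mul hgvs.transpose, fun x hx => by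
        rw [Matrix.mul_assoc]
        exact Matrix.nonsing_inv_mul _ ((Matrix.isUnit_iff_isUnit_det _).1 (hgvu x hx))⟩
  -- the change of output coordinates between the two row-reduced forms
  obtain ⟨T, hTs, hTu, hT⟩ : ∃ T : (Fin n → ℝ) → Matrix (Fin l) (Fin l) ℝ,
      SmoothMatOn T U ∧ (∀ x ∈ U, IsUnit (T x)) ∧
        ∀ x ∈ U, T x * Q₁ x = Q₂ (ψ x) * Q x := by
    refine ⟨fun x => Q₂ (ψ x) * Q x * (Q₁ x)⁻¹,
      ((SmoothMatOn.comp hQ₂ hψ hψX).mul hQ).mul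
        ((SmoothMatOn.mono hQ₁ hUX).inv fun x hx => hQ₁u x (hUX hx)), fun x hx => ?_,
      fun x hx => ?_⟩
    · exact ((hQ₂u _ (hψX hx)).mul (hQu x hx)).mul
        (Matrix.isUnit_nonsing_inv_iff.2 (hQ₁u x (hUX hx)))
    · simp only [Matrix.mul_assoc, hQ₁i x hx, Matrix.mul_one]
  have hTE : ∀ x ∈ U, T x * stackM hl (E₁ x) 0 = stackM hl (E₂ (ψ x) * J x) 0 := fun x hx => by
    rw [← hQE x (hUX hx), ← Matrix.mul_assoc, hT x hx,
      ← Matrix.zero_mul (l := Fin p) (J x), ← stackM_mul, ← hQEt _ (hψX hx), hEψ x hx]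
    simp only [Matrix.mul_assoc, hJiJ x hx, Matrix.mul_one]
  have hTF : ∀ x ∈ U, (T x).mulVec (stackV hl (F₁ x + (G₁ x).mulVec (α x))
      (h x + (lu x).mulVec (α x))) = stackV hl (F₂ (ψ x)) (ht (ψ x)) := fun x hx => by
    rw [← stackV_add_stackM_mulVec, ← hQF x (hUX hx), ← hQG x (hUX hx), ← hQFt _ (hψX hx),
      hFψ x hx, ← Matrix.mulVec_mulVec, ← Matrix.mulVec_add, Matrix.mulVec_mulVec, hT x hx,
      Matrix.mulVec_mulVec]
  have hTG : ∀ x ∈ U, T x * stackM hl (G₁ x * β x) (lu x * β x) =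
      stackM hl (G₂ (ψ x)) (lut (ψ x)) := fun x hx => by
    rw [← stackM_mul, ← hQG x (hUX hx), ← hQGt _ (hψX hx), hGψ x hx, ← Matrix.mul_assoc,
      ← Matrix.mul_assoc, hT x hx]
    simp only [Matrix.mul_assoc]
  let e := stackEquiv hl
  let T₁₁ := fun x => ((T x).submatrix e e).toBlocks₁₁
  let T₁₂ := fun x => ((T x).submatrix e e).toBlocks₁₂
  let T₂₁ := fun x => ((T x).submatrix e e).toBlocks₂₁
  let T₂₂ := fun x => ((T x).submatrix e e).toBlocks₂₂
  have hT₁₁s : SmoothMatOn T₁₁ U := fun i j => hTs _ _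
  have hT₁₂s : SmoothMatOn T₁₂ U := fun i j => hTs _ _
  have hT₂₂s : SmoothMatOn T₂₂ U := fun i j => hTs _ _
  have hT₁₁E : ∀ x ∈ U, T₁₁ x * E₁ x = E₂ (ψ x) * J x := fun x hx => by
    simpa using (blocks_of_mul_stackM hl (hTE x hx)).1
  have hT₂₁ : ∀ x ∈ U, T₂₁ x = 0 := fun x hx => by
    have h1 : T₂₁ x * E₁ x = 0 := by simpa using (blocks_of_mul_stackM hl (hTE x hx)).2
    rw [← Matrix.mul_one (T₂₁ x), ← hE₁E x (hUX hx), ← Matrix.mul_assoc, h1, Matrix.zero_mul]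
  have hTuu : ∀ x ∈ U, IsUnit (T₁₁ x) ∧ IsUnit (T₂₂ x) := fun x hx => by
    have h1 := (Matrix.isUnit_submatrix_equiv e e).2 (hTu x hx)
    rw [← Matrix.fromBlocks_toBlocks ((T x).submatrix e e)] at h1
    have h2 : ((T x).submatrix e e).toBlocks₂₁ = 0 := hT₂₁ x hx
    rw [h2] at h1
    exact Matrix.isUnit_fromBlocks_zero₂₁.1 h1
  have hF₂ : ∀ x ∈ U, F₂ (ψ x) = (T₁₁ x).mulVec (F₁ x + (G₁ x).mulVec (α x)) +
      (T₁₂ x).mulVec (h x + (lu x).mulVec (α x)) := fun x hx =>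
    (blocks_of_mulVec_stackV hl (hTF x hx)).1.symm
  have hht : ∀ x ∈ U, ht (ψ x) = (T₂₂ x).mulVec (h x + (lu x).mulVec (α x)) := fun x hx => by
    have h1 : (T₂₁ x).mulVec _ + (T₂₂ x).mulVec _ = _ :=
      (blocks_of_mulVec_stackV hl (hTF x hx)).2
    rw [← h1, hT₂₁ x hx, Matrix.zero_mulVec, zero_add]
  have hG₂ : ∀ x ∈ U, G₂ (ψ x) = T₁₁ x * (G₁ x * β x) + T₁₂ x * (lu x * β x) := fun x hx =>
    (blocks_of_mul_stackM hl (hTG x hx)).1.symm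
  have hlut : ∀ x ∈ U, lut (ψ x) = T₂₂ x * (lu x * β x) := fun x hx => by
    have h1 : T₂₁ x * (G₁ x * β x) + T₂₂ x * (lu x * β x) = lut (ψ x) :=
      (blocks_of_mul_stackM hl (hTG x hx)).2
    rw [← h1, hT₂₁ x hx, Matrix.zero_mul, zero_add]
  have hF₁s : ContDiffOn ℝ (⊤ : ℕ∞) F₁ U := by
    have h1 := SmoothMatOn.mulVec (SmoothMatOn.mono hQ₁ hUX) (hF.mono hUX)
    refine contDiffOn_pi.2 fun i => (contDiffOn_pi.1 h1 (e (Sum.inl i))).congr fun x hx => ?_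
    rw [hQF x (hUX hx), stackV_apply_inl]
  have hG₁s : SmoothMatOn G₁ U := fun i j => by
    have h1 := SmoothMatOn.mul (SmoothMatOn.mono hQ₁ hUX) (SmoothMatOn.mono hG hUX)
    refine (h1 (e (Sum.inl i)) j).congr fun x hx => ?_
    simp only [hQG x (hUX hx)]
    exact (stackM_apply_inl hl _ _ i j).symm
  have hE₂ds : SmoothMatOn (fun x => E₂d (ψ x)) U := SmoothMatOn.comp hE₂d hψ hψX
  have hgvts : SmoothMatOn (fun x => gvt (ψ x)) U := SmoothMatOn.comp hgvt hψ hψX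
  -- the difference of the two right inverses of `E₁` is absorbed by the driving variables
  let M := fun x => L x * ((J x)⁻¹ * E₂d (ψ x) * T₁₁ x - E₁d x)
  have hMs : SmoothMatOn M U :=
    hLs.mul (((hJis.mul hE₂ds).mul hT₁₁s).sub (SmoothMatOn.mono hE₁d hUX))
  have hE₁J : ∀ x ∈ U, T₁₁ x * (E₁ x * (J x)⁻¹) = E₂ (ψ x) := fun x hx => by
    rw [← Matrix.mul_assoc, hT₁₁E x hx, Matrix.mul_assoc, hJJi x hx, Matrix.mul_one]
  have hcancel : ∀ x ∈ U, ∀ {k : ℕ} (A B : Matrix (Fin r) (Fin k) ℝ),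
      T₁₁ x * A = T₁₁ x * B → A = B := fun x hx k A B hAB => by
    have hu := (Matrix.isUnit_iff_isUnit_det _).1 (hTuu x hx).1
    rw [← Matrix.nonsing_inv_mul_cancel_left (T₁₁ x) A hu, hAB,
      Matrix.nonsing_inv_mul_cancel_left (T₁₁ x) B hu]
  have hM : ∀ x ∈ U, E₂d (ψ x) * T₁₁ x = J x * (E₁d x + gv x * M x) := fun x hx => by
    have h1 : E₁ x * ((J x)⁻¹ * E₂d (ψ x) * T₁₁ x - E₁d x) = 0 := by
      apply hcancel x hx
      rw [Matrix.mul_sub, hE₁E x (hUX hx), Matrix.mul_sub, Matrix.mul_one, Matrix.mul_zero,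
        ← Matrix.mul_assoc, ← Matrix.mul_assoc, ← Matrix.mul_assoc, Matrix.mul_assoc (T₁₁ x),
        hE₁J x hx, hE₂E _ (hψX hx), Matrix.one_mul, sub_self]
    rw [mul_mul_eq_of_range_eq_ker (hgvr x (hUX hx)) (hL x hx) h1, add_sub_cancel,
      ← Matrix.mul_assoc, ← Matrix.mul_assoc, hJJi x hx, Matrix.one_mul]
  have hgvt_eq : ∀ x ∈ U, gvt (ψ x) = J x * (gv x * (L x * ((J x)⁻¹ * gvt (ψ x)))) :=
    fun x hx => by
      have h1 : E₁ x * ((J x)⁻¹ * gvt (ψ x)) = 0 := by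
        apply hcancel x hx
        rw [← Matrix.mul_assoc, ← Matrix.mul_assoc, Matrix.mul_assoc (T₁₁ x), hE₁J x hx,
          mul_eq_zero_of_range_eq_ker (hgvtr _ (hψX hx)), Matrix.mul_zero]
      rw [mul_mul_eq_of_range_eq_ker (hgvr x (hUX hx)) (hL x hx) h1, ← Matrix.mul_assoc,
        hJJi x hx, Matrix.one_mul]
  have hγ : ∀ x ∈ U, E₂d (ψ x) * T₁₂ x = J x * ((J x)⁻¹ * E₂d (ψ x) * T₁₂ x) := fun x hx => by
    rw [← Matrix.mul_assoc, ← Matrix.mul_assoc, hJJi x hx, Matrix.one_mul]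
  refine ⟨U, Ut, ψ, ψinv, J, α, fun x => (M x).mulVec (F₁ x), fun x => M x * G₁ x,
    fun x => (J x)⁻¹ * E₂d (ψ x) * T₁₂ x, β, fun x => L x * ((J x)⁻¹ * gvt (ψ x)), T₂₂,
    hU, hUt, hxU, hxUt, hUX, hUtX, hψp, hψm, hψim, hψl, hψr, hψ, hψi, hJ, hJu, hα,
    hMs.mulVec hF₁s, hMs.mul hG₁s, (hJis.mul hE₂ds).mul hT₁₂s, hβ,
    hLs.mul (hJis.mul hgvts), hT₂₂s, hβu, fun x hx => ?_, fun x hx => (hTuu x hx).2,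
    fun x hx => ?_, fun x hx => ?_, hgvt_eq, hht, hlut⟩
  · rw [← Matrix.mulVec_injective_iff_isUnit]
    have h1 := mulVec_injective_of_range_eq_ker hn (hE₂s _ (hψX hx)) (hgvtr _ (hψX hx))
    rw [hgvt_eq x hx] at h1
    intro v w hvw
    apply h1
    simp only [← Matrix.mulVec_mulVec] at hvw ⊢
    rw [hvw]
  · rw [hft _ (hψX hx), hF₂ x hx, Matrix.mulVec_add, Matrix.mulVec_mulVec, Matrix.mulVec_mulVec,
      hM x hx, hγ x hx, hf x (hUX hx), hgu x (hUX hx)]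
    simp only [← Matrix.mulVec_mulVec, Matrix.add_mulVec, Matrix.mulVec_add]
    abel
  · rw [hgut _ (hψX hx), hG₂ x hx, Matrix.mul_add, ← Matrix.mul_assoc, ← Matrix.mul_assoc (E₂d (ψ x)),
      hM x hx, hγ x hx, hgu x (hUX hx)]
    simp only [Matrix.mul_assoc, Matrix.add_mul, Matrix.mul_add]
end

section
/- Let Q = [[Q₁, Q₂],[Q₃, Q₄]] ∈ GL(l,ℝ) be an invertible block matrix with Q₁ ∈ ℝ^{r×r}, let P ∈ GL(n,ℝ), and let E₁, Ẽ₁ ∈ ℝ^{r×n} be of full row rank r (r ≤ l). If Q·[E₁; 0] = [Ẽ₁; 0]·P (where [E₁; 0] and [Ẽ₁; 0] are l × n matrices whose last l − r rows are zero), then Q₃ = 0, Q₁ is invertible, Q₄ is invertible, and Ẽ₁ = Q₁E₁P⁻¹. -/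
open Matrix

/-- A matrix that annihilates a surjective matrix from the left is zero. -/
theorem eq_zero_of_mul_eq_zero_of_surjective {R k m n : Type*} [CommSemiring R] [Fintype m]
    [Fintype n] {A : Matrix k m R} {B : Matrix m n R}
    (hB : Function.Surjective B.mulVecLin) (h : A * B = 0) : A = 0 := by
  classical
  refine ext_of_mulVec_single fun i => ?_
  obtain ⟨v, hv⟩ := hB (Pi.single i 1)
  rw [← hv, mulVecLin_apply, mulVec_mulVec, h, zero_mulVec, zero_mulVec]

/-- If an invertible block matrix `Q = [[Q₁,Q₂],[Q₃,Q₄]]` and invertible `P`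
satisfy `Q·[E₁;0] = [Ẽ₁;0]·P` with `E₁, Ẽ₁` of full row rank `r`, then `Q₃ = 0`,
`Q₁` and `Q₄` are invertible, and `Ẽ₁ = Q₁E₁P⁻¹`. -/
theorem stmt_5 {r p n : ℕ}
    (Q₁ : Matrix (Fin r) (Fin r) ℝ) (Q₂ : Matrix (Fin r) (Fin p) ℝ)
    (Q₃ : Matrix (Fin p) (Fin r) ℝ) (Q₄ : Matrix (Fin p) (Fin p) ℝ)
    (P : Matrix (Fin n) (Fin n) ℝ)
    (E₁ Etil₁ : Matrix (Fin r) (Fin n) ℝ)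
    (hQ : IsUnit (Matrix.fromBlocks Q₁ Q₂ Q₃ Q₄))
    (hP : IsUnit P)
    (hE₁ : Function.Surjective E₁.mulVecLin)
    (hEtil₁ : Function.Surjective Etil₁.mulVecLin)
    (heq : Matrix.fromBlocks Q₁ Q₂ Q₃ Q₄ *
        Matrix.fromRows E₁ (0 : Matrix (Fin p) (Fin n) ℝ) =
      Matrix.fromRows Etil₁ (0 : Matrix (Fin p) (Fin n) ℝ) * P) :
    Q₃ = 0 ∧ IsUnit Q₁ ∧ IsUnit Q₄ ∧ Etil₁ = Q₁ * E₁ * P⁻¹ := by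
  rw [fromBlocks_mul_fromRows, fromRows_mul] at heq
  simp only [Matrix.mul_zero, Matrix.zero_mul, add_zero] at heq
  obtain ⟨h₁, h₃⟩ := fromRows_inj.eq_iff.mp heq
  have hQ₃ : Q₃ = 0 := eq_zero_of_mul_eq_zero_of_surjective hE₁ h₃
  subst hQ₃
  obtain ⟨hQ₁, hQ₄⟩ := isUnit_fromBlocks_zero₂₁.mp hQ
  refine ⟨rfl, hQ₁, hQ₄, ?_⟩
  rw [h₁, mul_nonsing_inv_cancel_right _ _ ((isUnit_iff_isUnit_det P).mp hP)]
end

section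
/- Let f, g^u, g^v be C^∞ vector fields on an open set U ⊆ ℝⁿ with g^u(z) and g^v(z) linearly independent for all z ∈ U, and assume the linearizability distributions D_i and D̂_i (built from f, g^u, g^v) have constant dimension on U for 1 ≤ i ≤ n and satisfy D_n(x) = D̂_n(x) = ℝⁿ for all x ∈ U. Define ρ := max{i ∈ ℕ, i ≥ 1 : D̂_i ≠ D_i} and ρ̄ := max{i ∈ ℕ, i ≥ 1 : D_{i−1} ≠ D̂_i} (with D₀ = 0). Then ρ and ρ̄ are well defined (the maxima exist), equality propagates (D̂_i = D_i implies D̂_{i+1} = D_{i+1}, and D̂_i = D_{i−1} implies D̂_{i+1} = D_i), and ρ + ρ̄ = n. -/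
open Matrix Set

/-- The Lie bracket `[f,g](x) = Dg(x)f(x) − Df(x)g(x)` of vector fields on `ℝⁿ`. -/
noncomputable def lieB {n : ℕ} (f g : (Fin n → ℝ) → Fin n → ℝ) : (Fin n → ℝ) → Fin n → ℝ :=
  fun x => fderiv ℝ g x (f x) - fderiv ℝ f x (g x)

/-- Iterated adjoint: `ad_f⁰ g = g`, `ad_f^{q+1} g = [f, ad_f^q g]`. -/
noncomputable def adIter {n : ℕ} (f g : (Fin n → ℝ) → Fin n → ℝ) :
    ℕ → (Fin n → ℝ) → Fin n → ℝ
  | 0 => g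
  | q + 1 => lieB f (adIter f g q)

/-- The linearizability distribution `D_i(x)` (case of single `g^u`, `g^v`);
`D₀(x) = 0`. -/
noncomputable def distLin {n : ℕ} (f gu gv : (Fin n → ℝ) → Fin n → ℝ)
    (i : ℕ) (x : Fin n → ℝ) : Submodule ℝ (Fin n → ℝ) :=
  Submodule.span ℝ {w | ∃ q < i, w = adIter f gu q x ∨ w = adIter f gv q x}

/-- The linearizability distribution `D̂_i(x) = D_{i−1}(x) + span{ad_f^{i−1} g^v(x)}`,
for `i ≥ 1`. -/
noncomputable def distHat {n : ℕ} (f gu gv : (Fin n → ℝ) → Fin n → ℝ)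
    (i : ℕ) (x : Fin n → ℝ) : Submodule ℝ (Fin n → ℝ) :=
  distLin f gu gv (i - 1) x ⊔ Submodule.span ℝ {adIter f gv (i - 1) x}

open Topology

/-- A field `h` that stays in the span of a family of differentiable vector fields, whose span has
locally constant dimension, has its bracket with `f` in any subspace containing the fields of the
family and their brackets with `f`. -/
lemma lieB_mem_of_eventually_mem_span {n : ℕ} {f h : (Fin n → ℝ) → Fin n → ℝ}
    {S : Set ((Fin n → ℝ) → Fin n → ℝ)} {x₀ : Fin n → ℝ} {M : Submodule ℝ (Fin n → ℝ)}
    (hS : ∀ w ∈ S, DifferentiableAt ℝ w x₀) (hh : DifferentiableAt ℝ h x₀)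
    (hmem : ∀ᶠ x in 𝓝 x₀, h x ∈ Submodule.span ℝ ((fun w => w x) '' S))
    (hrank : ∀ᶠ x in 𝓝 x₀, Module.finrank ℝ (Submodule.span ℝ ((fun w => w x) '' S)) =
      Module.finrank ℝ (Submodule.span ℝ ((fun w => w x₀) '' S)))
    (hM : ∀ w ∈ S, w x₀ ∈ M ∧ lieB f w x₀ ∈ M) :
    lieB f h x₀ ∈ M := by
  obtain ⟨κ, a, -, hspan, hli⟩ := exists_linearIndependent' ℝ (fun w : S => w.1 x₀)
  have hfin : Finite κ := hli.finite
  have := Fintype.ofFinite κ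
  classical
  let W : (Fin n → ℝ) → (κ → ℝ) →L[ℝ] (Fin n → ℝ) := fun x =>
    ∑ j, (ContinuousLinearMap.proj (R := ℝ) (φ := fun _ : κ => ℝ) j).smulRight ((a j).1 x)
  have hW : ∀ x c, W x c = ∑ j, c j • (a j).1 x := by
    intro x c
    simp [W]
  have hWd : DifferentiableAt ℝ W x₀ := by
    refine DifferentiableAt.fun_sum fun j _ => ?_
    exact ((ContinuousLinearMap.smulRightL ℝ (κ → ℝ) (Fin n → ℝ)
      (ContinuousLinearMap.proj j)).differentiableAt).comp x₀ (hS _ (a j).2)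
  have hker : LinearMap.ker (W x₀ : (κ → ℝ) →ₗ[ℝ] (Fin n → ℝ)) = ⊥ := by
    rw [LinearMap.ker_eq_bot']
    intro c hc
    rw [ContinuousLinearMap.coe_coe, hW] at hc
    exact funext (Fintype.linearIndependent_iff.1 hli c hc)
  obtain ⟨L', hL'⟩ := LinearMap.exists_leftInverse_of_injective _ hker
  let L : (Fin n → ℝ) →L[ℝ] (κ → ℝ) := LinearMap.toContinuousLinearMap L'
  let A : (Fin n → ℝ) → ((κ → ℝ) →L[ℝ] (κ → ℝ)) := fun x => L.comp (W x)
  have hA₀ : A x₀ = 1 := by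
    ext1 c
    exact LinearMap.congr_fun hL' c
  have hAd : DifferentiableAt ℝ A x₀ := (differentiableAt_const L).clm_comp hWd
  let c : (Fin n → ℝ) → κ → ℝ := fun x => Ring.inverse (A x) (L (h x))
  have hcd : DifferentiableAt ℝ c x₀ := by
    refine DifferentiableAt.clm_apply ?_ (L.differentiableAt.comp x₀ hh)
    refine DifferentiableAt.comp (g := Ring.inverse) x₀ ?_ hAd
    rw [hA₀]
    exact differentiableAt_inverse isUnit_one
  have hunit : ∀ᶠ x in 𝓝 x₀, IsUnit (A x) :=
    hAd.continuousAt.eventually (Units.isOpen.mem_nhds (by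
      change IsUnit (A x₀); rw [hA₀]; exact isUnit_one))
  have hrepr : ∀ᶠ x in 𝓝 x₀, h x = ∑ j, c x j • (a j).1 x := by
    filter_upwards [hunit, hmem, hrank] with x hu hm hr
    have hinv : ∀ b, Ring.inverse (A x) (A x b) = b := fun b => by
      rw [← mul_apply_eq_comp, Ring.inverse_mul_cancel _ hu]; rfl
    have hlix : LinearIndependent ℝ (fun j => (a j).1 x) := by
      rw [Fintype.linearIndependent_iff]
      intro b hb
      rw [← hW] at hb
      have := hinv b
      rw [show A x b = L (W x b) from rfl, hb] at this
      intro j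
      rw [← this]; simp
    have hle : Submodule.span ℝ (range fun j => (a j).1 x) ≤
        Submodule.span ℝ ((fun w => w x) '' S) :=
      Submodule.span_mono (by rintro _ ⟨j, rfl⟩; exact ⟨_, (a j).2, rfl⟩)
    have heq := Submodule.eq_of_le_of_finrank_eq hle (by
      rw [hr, finrank_span_eq_card hlix, ← finrank_span_eq_card hli, hspan, image_eq_range])
    rw [← heq, Submodule.mem_span_range_iff_exists_fun] at hm
    obtain ⟨b, hb⟩ := hm
    rw [← hW] at hb
    have : c x = b := by
      simp only [c]; rw [← hb]; exact hinv b
    rw [this, ← hW, hb]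
  have hcj : ∀ j, DifferentiableAt ℝ (fun x => c x j) x₀ := differentiableAt_pi.1 hcd
  have hder : fderiv ℝ h x₀ (f x₀) = ∑ j, (c x₀ j • fderiv ℝ (a j).1 x₀ (f x₀) +
      fderiv ℝ (fun x => c x j) x₀ (f x₀) • (a j).1 x₀) := by
    rw [Filter.EventuallyEq.fderiv_eq (show h =ᶠ[𝓝 x₀] fun x => ∑ j, c x j • (a j).1 x from hrepr),
      fderiv_fun_sum fun j _ => (hcj j).fun_smul (hS _ (a j).2), _root_.sum_apply]
    refine Finset.sum_congr rfl fun j _ => ?_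
    rw [fderiv_fun_smul (hcj j) (hS _ (a j).2)]
    simp
  have hlie : lieB f h x₀ = ∑ j, (c x₀ j • lieB f (a j).1 x₀ +
      fderiv ℝ (fun x => c x j) x₀ (f x₀) • (a j).1 x₀) := by
    rw [lieB, hder, hrepr.self_of_nhds, map_sum, ← Finset.sum_sub_distrib]
    refine Finset.sum_congr rfl fun j _ => ?_
    rw [lieB, map_smul, smul_sub]
    abel
  rw [hlie]
  exact M.sum_mem fun j _ => M.add_mem (M.smul_mem _ (hM _ (a j).2).2) (M.smul_mem _ (hM _ (a j).2).1)

lemma contDiffOn_adIter {n : ℕ} {U : Set (Fin n → ℝ)} (hU : IsOpen U)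
    {f g : (Fin n → ℝ) → Fin n → ℝ} (hf : ContDiffOn ℝ (⊤ : ℕ∞) f U)
    (hg : ContDiffOn ℝ (⊤ : ℕ∞) g U) (q : ℕ) : ContDiffOn ℝ (⊤ : ℕ∞) (adIter f g q) U := by
  induction q with
  | zero => exact hg
  | succ q ih =>
    exact ((ih.fderiv_of_isOpen hU (by simp)).clm_apply hf).sub
      ((hf.fderiv_of_isOpen hU (by simp)).clm_apply ih)

/-- The vector fields generating `distLin f gu gv i`. -/
def linFields {n : ℕ} (f gu gv : (Fin n → ℝ) → Fin n → ℝ) (i : ℕ) :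
    Set ((Fin n → ℝ) → Fin n → ℝ) :=
  {w | ∃ q < i, w = adIter f gu q ∨ w = adIter f gv q}

section Distributions

variable {n : ℕ} {f gu gv : (Fin n → ℝ) → Fin n → ℝ}

lemma distLin_eq_span_image (i : ℕ) (x : Fin n → ℝ) :
    distLin f gu gv i x = Submodule.span ℝ ((fun w => w x) '' linFields f gu gv i) := by
  rw [distLin]
  congr 1
  ext w
  constructor
  · rintro ⟨q, hq, rfl | rfl⟩
    · exact ⟨_, ⟨q, hq, Or.inl rfl⟩, rfl⟩
    · exact ⟨_, ⟨q, hq, Or.inr rfl⟩, rfl⟩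
  · rintro ⟨_, ⟨q, hq, rfl | rfl⟩, rfl⟩
    · exact ⟨q, hq, Or.inl rfl⟩
    · exact ⟨q, hq, Or.inr rfl⟩

lemma distHat_succ_eq_span_image (i : ℕ) (x : Fin n → ℝ) :
    distHat f gu gv (i + 1) x =
      Submodule.span ℝ ((fun w => w x) '' insert (adIter f gv i) (linFields f gu gv i)) := by
  rw [distHat, image_insert_eq, Submodule.span_insert, sup_comm, Nat.add_sub_cancel,
    distLin_eq_span_image]

lemma adIter_left_mem_distLin {q i : ℕ} (h : q < i) (x : Fin n → ℝ) :
    adIter f gu q x ∈ distLin f gu gv i x :=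
  Submodule.subset_span ⟨q, h, Or.inl rfl⟩

lemma adIter_right_mem_distLin {q i : ℕ} (h : q < i) (x : Fin n → ℝ) :
    adIter f gv q x ∈ distLin f gu gv i x :=
  Submodule.subset_span ⟨q, h, Or.inr rfl⟩

lemma distLin_mono {i j : ℕ} (h : i ≤ j) (x : Fin n → ℝ) :
    distLin f gu gv i x ≤ distLin f gu gv j x :=
  Submodule.span_mono fun _ ⟨q, hq, hw⟩ => ⟨q, hq.trans_le h, hw⟩

lemma distLin_zero (x : Fin n → ℝ) : distLin f gu gv 0 x = ⊥ := by
  simp [distLin]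

lemma distLin_le_distHat_succ (i : ℕ) (x : Fin n → ℝ) :
    distLin f gu gv i x ≤ distHat f gu gv (i + 1) x :=
  le_sup_left

lemma adIter_mem_distHat_succ (i : ℕ) (x : Fin n → ℝ) :
    adIter f gv i x ∈ distHat f gu gv (i + 1) x :=
  (le_sup_right : _ ≤ distHat f gu gv (i + 1) x) (Submodule.mem_span_singleton_self _)

lemma distHat_succ_le_distLin_succ (i : ℕ) (x : Fin n → ℝ) :
    distHat f gu gv (i + 1) x ≤ distLin f gu gv (i + 1) x :=
  sup_le (distLin_mono i.le_succ x)
    ((Submodule.span_singleton_le_iff_mem _ _).2 (adIter_right_mem_distLin i.lt_succ_self x))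

lemma distLin_succ_eq (i : ℕ) (x : Fin n → ℝ) :
    distLin f gu gv (i + 1) x =
      distHat f gu gv (i + 1) x ⊔ Submodule.span ℝ {adIter f gu i x} := by
  refine le_antisymm (Submodule.span_le.2 ?_) (sup_le (distHat_succ_le_distLin_succ i x)
    ((Submodule.span_singleton_le_iff_mem _ _).2 (adIter_left_mem_distLin i.lt_succ_self x)))
  have hl : distHat f gu gv (i + 1) x ≤
    distHat f gu gv (i + 1) x ⊔ Submodule.span ℝ {adIter f gu i x} := le_sup_left
  rintro _ ⟨q, hq, hw⟩
  rcases Nat.lt_succ_iff_lt_or_eq.1 hq with h | rfl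
  · exact hl (distLin_le_distHat_succ i x (Submodule.subset_span ⟨q, h, hw⟩))
  · rcases hw with rfl | rfl
    · exact (le_sup_right : Submodule.span ℝ {adIter f gu q x} ≤ _)
        (Submodule.mem_span_singleton_self _)
    · exact hl (adIter_mem_distHat_succ q x)

lemma distHat_succ_eq_distLin_succ_iff (i : ℕ) (x : Fin n → ℝ) :
    distHat f gu gv (i + 1) x = distLin f gu gv (i + 1) x ↔
      adIter f gu i x ∈ distHat f gu gv (i + 1) x := by
  rw [distLin_succ_eq, left_eq_sup, Submodule.span_singleton_le_iff_mem]

lemma distHat_succ_eq_distLin_iff (i : ℕ) (x : Fin n → ℝ) :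
    distHat f gu gv (i + 1) x = distLin f gu gv i x ↔
      adIter f gv i x ∈ distLin f gu gv i x := by
  rw [distHat, Nat.add_sub_cancel, sup_eq_left, Submodule.span_singleton_le_iff_mem]

variable {U : Set (Fin n → ℝ)}

lemma distHat_eq_distLin_propagates (hU : IsOpen U) (hf : ContDiffOn ℝ (⊤ : ℕ∞) f U)
    (hgu : ContDiffOn ℝ (⊤ : ℕ∞) gu U) (hgv : ContDiffOn ℝ (⊤ : ℕ∞) gv U) {i : ℕ}
    (hd : ∃ d, ∀ x ∈ U, Module.finrank ℝ ↥(distHat f gu gv (i + 1) x) = d)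
    (h : ∀ x ∈ U, distHat f gu gv (i + 1) x = distLin f gu gv (i + 1) x) :
    ∀ x ∈ U, distHat f gu gv (i + 2) x = distLin f gu gv (i + 2) x := by
  intro x hx
  have hdu := fun q => ((contDiffOn_adIter hU hf hgu q).differentiableOn (by simp)).differentiableAt
    (hU.mem_nhds hx)
  have hdv := fun q => ((contDiffOn_adIter hU hf hgv q).differentiableOn (by simp)).differentiableAt
    (hU.mem_nhds hx)
  have hle := distLin_le_distHat_succ (f := f) (gu := gu) (gv := gv) (i + 1) x
  obtain ⟨d, hd⟩ := hd
  rw [distHat_succ_eq_distLin_succ_iff]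
  refine lieB_mem_of_eventually_mem_span
    (S := insert (adIter f gv i) (linFields f gu gv i)) ?_ (hdu i) ?_ ?_ ?_
  · rintro w (rfl | ⟨q, -, rfl | rfl⟩)
    exacts [hdv i, hdu q, hdv q]
  · filter_upwards [hU.mem_nhds hx] with y hy
    rw [← distHat_succ_eq_span_image]
    exact (distHat_succ_eq_distLin_succ_iff i y).1 (h y hy)
  · filter_upwards [hU.mem_nhds hx] with y hy
    rw [← distHat_succ_eq_span_image, ← distHat_succ_eq_span_image, hd y hy, hd x hx]
  · rintro w (rfl | ⟨q, hq, rfl | rfl⟩)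
    · exact ⟨hle (adIter_right_mem_distLin (by omega) x), adIter_mem_distHat_succ (i + 1) x⟩
    · exact ⟨hle (adIter_left_mem_distLin (by omega) x),
        hle (adIter_left_mem_distLin (q := q + 1) (by omega) x)⟩
    · exact ⟨hle (adIter_right_mem_distLin (by omega) x),
        hle (adIter_right_mem_distLin (q := q + 1) (by omega) x)⟩

lemma distHat_eq_distLin_pred_propagates (hU : IsOpen U) (hf : ContDiffOn ℝ (⊤ : ℕ∞) f U)
    (hgu : ContDiffOn ℝ (⊤ : ℕ∞) gu U) (hgv : ContDiffOn ℝ (⊤ : ℕ∞) gv U) {i : ℕ}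
    (hd : ∃ d, ∀ x ∈ U, Module.finrank ℝ ↥(distLin f gu gv i x) = d)
    (h : ∀ x ∈ U, distHat f gu gv (i + 1) x = distLin f gu gv i x) :
    ∀ x ∈ U, distHat f gu gv (i + 2) x = distLin f gu gv (i + 1) x := by
  intro x hx
  have hdu := fun q => ((contDiffOn_adIter hU hf hgu q).differentiableOn (by simp)).differentiableAt
    (hU.mem_nhds hx)
  have hdv := fun q => ((contDiffOn_adIter hU hf hgv q).differentiableOn (by simp)).differentiableAt
    (hU.mem_nhds hx)
  obtain ⟨d, hd⟩ := hd
  rw [distHat_succ_eq_distLin_iff]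
  refine lieB_mem_of_eventually_mem_span (S := linFields f gu gv i) ?_ (hdv i) ?_ ?_ ?_
  · rintro w ⟨q, -, rfl | rfl⟩
    exacts [hdu q, hdv q]
  · filter_upwards [hU.mem_nhds hx] with y hy
    rw [← distLin_eq_span_image]
    exact (distHat_succ_eq_distLin_iff i y).1 (h y hy)
  · filter_upwards [hU.mem_nhds hx] with y hy
    rw [← distLin_eq_span_image, ← distLin_eq_span_image, hd y hy, hd x hx]
  · rintro w ⟨q, hq, rfl | rfl⟩
    · exact ⟨adIter_left_mem_distLin (by omega) x,
        adIter_left_mem_distLin (q := q + 1) (by omega) x⟩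
    · exact ⟨adIter_right_mem_distLin (by omega) x,
        adIter_right_mem_distLin (q := q + 1) (by omega) x⟩

end Distributions

lemma Submodule.forall_eq_of_exists_eq {X V : Type*} [AddCommGroup V] [Module ℝ V]
    [FiniteDimensional ℝ V] {U : Set X} {A B : X → Submodule ℝ V} (hle : ∀ x, A x ≤ B x)
    (hA : ∃ d, ∀ x ∈ U, Module.finrank ℝ (A x) = d)
    (hB : ∃ d, ∀ x ∈ U, Module.finrank ℝ (B x) = d) {x₀ : X} (hx₀ : x₀ ∈ U) (h : A x₀ = B x₀) :
    ∀ x ∈ U, A x = B x := by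
  obtain ⟨a, ha⟩ := hA
  obtain ⟨b, hb⟩ := hB
  intro x hx
  refine Submodule.eq_of_le_of_finrank_eq (hle x) ?_
  rw [ha x hx, hb x hx, ← ha x₀ hx₀, ← hb x₀ hx₀, h]

lemma Submodule.finrank_sup_span_singleton_of_notMem {V : Type*} [AddCommGroup V] [Module ℝ V]
    [FiniteDimensional ℝ V] (A : Submodule ℝ V) {v : V} (h : v ∉ A) :
    Module.finrank ℝ ↥(A ⊔ Submodule.span ℝ {v}) = Module.finrank ℝ A + 1 := by
  have hlt : A < A ⊔ Submodule.span ℝ {v} :=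
    left_lt_sup.2 fun hle => h ((Submodule.span_singleton_le_iff_mem _ _).1 hle)
  have h₁ := Submodule.finrank_lt_finrank_of_lt hlt
  have h₂ := Submodule.finrank_add_le_finrank_add_finrank A (Submodule.span ℝ {v})
  have h₃ := finrank_span_le_card (R := ℝ) ({v} : Set V)
  simp only [Set.toFinset_singleton, Finset.card_singleton] at h₃
  omega

lemma Nat.exists_forall_iff_lt_of_not_propagates {P : ℕ → Prop} {m : ℕ} (hm : ¬ P m)
    (hstep : ∀ i, ¬ P i → ¬ P (i + 1)) : ∃ r ≤ m, ∀ i, P i ↔ i < r := by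
  classical
  have hex : ∃ i, ¬ P i := ⟨m, hm⟩
  refine ⟨Nat.find hex, Nat.find_min' hex hm, fun i => ⟨fun hi => ?_, fun hi => ?_⟩⟩
  · by_contra! hle
    exact Nat.le_induction (Nat.find_spec hex) (fun j _ hj => hstep j hj) i hle hi
  · exact not_not.1 (Nat.find_min hex hi)

/-- Under constant dimensions and `D_n = D̂_n = ℝⁿ` on `U`, the indices
`ρ = max{i ≥ 1 : D̂_i ≠ D_i}` and `ρ̄ = max{i ≥ 1 : D_{i−1} ≠ D̂_i}` are well defined,
equality propagates, and `ρ + ρ̄ = n`. -/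
theorem stmt_10 {n : ℕ} (U : Set (Fin n → ℝ)) (hUo : IsOpen U) (hUne : U.Nonempty)
    (f gu gv : (Fin n → ℝ) → Fin n → ℝ)
    (hf : ContDiffOn ℝ (⊤ : ℕ∞) f U) (hgu : ContDiffOn ℝ (⊤ : ℕ∞) gu U) (hgv : ContDiffOn ℝ (⊤ : ℕ∞) gv U)
    (hindep : ∀ z ∈ U, LinearIndependent ℝ ![gu z, gv z])
    (hconst : ∀ i, 1 ≤ i → i ≤ n →
      (∃ d, ∀ x ∈ U, Module.finrank ℝ ↥(distLin f gu gv i x) = d) ∧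
      (∃ d, ∀ x ∈ U, Module.finrank ℝ ↥(distHat f gu gv i x) = d))
    (hfull : ∀ x ∈ U, distLin f gu gv n x = ⊤ ∧ distHat f gu gv n x = ⊤) :
    ∃ ρ ρbar : ℕ,
      (1 ≤ ρ ∧ (∃ x ∈ U, distHat f gu gv ρ x ≠ distLin f gu gv ρ x) ∧
        (∀ i, 1 ≤ i → (∃ x ∈ U, distHat f gu gv i x ≠ distLin f gu gv i x) → i ≤ ρ)) ∧
      (1 ≤ ρbar ∧ (∃ x ∈ U, distLin f gu gv (ρbar - 1) x ≠ distHat f gu gv ρbar x) ∧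
        (∀ i, 1 ≤ i → (∃ x ∈ U, distLin f gu gv (i - 1) x ≠ distHat f gu gv i x) → i ≤ ρbar)) ∧
      (∀ i, 1 ≤ i → (∀ x ∈ U, distHat f gu gv i x = distLin f gu gv i x) →
        ∀ x ∈ U, distHat f gu gv (i + 1) x = distLin f gu gv (i + 1) x) ∧
      (∀ i, 1 ≤ i → (∀ x ∈ U, distHat f gu gv i x = distLin f gu gv (i - 1) x) →
        ∀ x ∈ U, distHat f gu gv (i + 1) x = distLin f gu gv i x) ∧
      ρ + ρbar = n := by
  obtain ⟨x₀, hx₀⟩ := hUne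
  have hlinconst : ∀ i ≤ n, ∃ d, ∀ x ∈ U, Module.finrank ℝ ↥(distLin f gu gv i x) = d := by
    intro i hi
    rcases Nat.eq_zero_or_pos i with rfl | hpos
    · exact ⟨0, fun x _ => by rw [distLin_zero, finrank_bot]⟩
    · exact (hconst i hpos hi).1
  have htop : ∀ i, n ≤ i → ∀ x ∈ U, distLin f gu gv i x = ⊤ := fun i hi x hx =>
    top_le_iff.1 ((hfull x hx).1 ▸ distLin_mono hi x)
  have htopHat : ∀ i, n ≤ i → ∀ x ∈ U, distHat f gu gv (i + 1) x = ⊤ := fun i hi x hx =>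
    top_le_iff.1 (htop i hi x hx ▸ distLin_le_distHat_succ i x)
  have hprop : ∀ i, (∀ x ∈ U, distHat f gu gv (i + 1) x = distLin f gu gv (i + 1) x) →
      ∀ x ∈ U, distHat f gu gv (i + 2) x = distLin f gu gv (i + 2) x := by
    intro i h
    rcases Nat.lt_or_ge i n with hi | hi
    · exact distHat_eq_distLin_propagates hUo hf hgu hgv (hconst (i + 1) (by omega) hi).2 h
    · intro x hx
      rw [htopHat (i + 1) (by omega) x hx, htop (i + 2) (by omega) x hx]
  have hprop' : ∀ i, (∀ x ∈ U, distHat f gu gv (i + 1) x = distLin f gu gv i x) →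
      ∀ x ∈ U, distHat f gu gv (i + 2) x = distLin f gu gv (i + 1) x := by
    intro i h
    rcases Nat.lt_or_ge i n with hi | hi
    · exact distHat_eq_distLin_pred_propagates hUo hf hgu hgv (hlinconst i hi.le) h
    · intro x hx
      rw [htopHat (i + 1) (by omega) x hx, htop (i + 1) (by omega) x hx]
  have hn : 1 ≤ n := by
    by_contra! h
    have h0 : n = 0 := by omega
    subst h0
    exact (hindep x₀ hx₀).ne_zero 0 (Subsingleton.elim _ _)
  obtain ⟨r, hrn, hr⟩ := Nat.exists_forall_iff_lt_of_not_propagates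
    (P := fun i => ∃ x ∈ U, distHat f gu gv (i + 1) x ≠ distLin f gu gv (i + 1) x) (m := n - 1)
    (by
      push Not
      intro x hx
      rw [Nat.sub_add_cancel hn, (hfull x hx).1, (hfull x hx).2])
    (fun i h => by push Not at h ⊢; exact hprop i h)
  obtain ⟨s, hsn, hs⟩ := Nat.exists_forall_iff_lt_of_not_propagates
    (P := fun i => ∃ x ∈ U, distLin f gu gv i x ≠ distHat f gu gv (i + 1) x) (m := n)
    (by
      push Not
      intro x hx
      rw [htop n le_rfl x hx, htopHat n le_rfl x hx])
    (fun i h => by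
      push Not at h ⊢
      exact fun x hx => (hprop' i (fun y hy => (h y hy).symm) x hx).symm)
  have hpair := LinearIndependent.pair_iff.1 (hindep x₀ hx₀)
  have hr0 : 0 < r := by
    refine (hr 0).1 ⟨x₀, hx₀, fun h => ?_⟩
    rw [distHat_succ_eq_distLin_succ_iff, distHat, distLin_zero, bot_sup_eq,
      Submodule.mem_span_singleton] at h
    obtain ⟨t, ht⟩ := h
    replace ht : t • gv x₀ = gu x₀ := ht
    simpa using (hpair 1 (-t) (by rw [← ht]; simp)).1
  have hs0 : 0 < s := by
    refine (hs 0).1 ⟨x₀, hx₀, fun h => ?_⟩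
    have h := (distHat_succ_eq_distLin_iff 0 x₀).1 h.symm
    rw [distLin_zero, Submodule.mem_bot] at h
    replace h : gv x₀ = 0 := h
    simpa using (hpair 0 1 (by rw [h]; simp)).2
  have hdim : ∀ i ≤ n, Module.finrank ℝ (distLin f gu gv i x₀) = min i r + min i s := by
    intro i
    induction i with
    | zero => intro _; rw [distLin_zero]; simp
    | succ i ih =>
      intro hi
      have ih := ih (by omega)
      have hHat : Module.finrank ℝ (distHat f gu gv (i + 1) x₀) =
          min i r + min (i + 1) s := by
        by_cases his : i < s
        · have hne : distHat f gu gv (i + 1) x₀ ≠ distLin f gu gv i x₀ := by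
            intro heq
            obtain ⟨x, hx, hxne⟩ := (hs i).2 his
            exact hxne (Submodule.forall_eq_of_exists_eq (distLin_le_distHat_succ i)
              (hlinconst i (by omega)) (hconst (i + 1) (by omega) hi).2 hx₀ heq.symm x hx)
          rw [Ne, distHat_succ_eq_distLin_iff] at hne
          rw [distHat, Nat.add_sub_cancel, Submodule.finrank_sup_span_singleton_of_notMem _ hne]
          omega
        · have heq : distLin f gu gv i x₀ = distHat f gu gv (i + 1) x₀ := by
            by_contra hne
            exact his ((hs i).1 ⟨x₀, hx₀, hne⟩)
          rw [← heq]
          omega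
      by_cases hir : i < r
      · have hne : distHat f gu gv (i + 1) x₀ ≠ distLin f gu gv (i + 1) x₀ := by
          intro heq
          obtain ⟨x, hx, hxne⟩ := (hr i).2 hir
          exact hxne (Submodule.forall_eq_of_exists_eq (distHat_succ_le_distLin_succ i)
            (hconst (i + 1) (by omega) hi).2 (hlinconst (i + 1) hi) hx₀ heq x hx)
        rw [Ne, distHat_succ_eq_distLin_succ_iff] at hne
        rw [distLin_succ_eq, Submodule.finrank_sup_span_singleton_of_notMem _ hne]
        omega
      · have heq : distHat f gu gv (i + 1) x₀ = distLin f gu gv (i + 1) x₀ := by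
          by_contra hne
          exact hir ((hr i).1 ⟨x₀, hx₀, hne⟩)
        rw [← heq]
        omega
  have hsum : r + s = n := by
    have h := hdim n le_rfl
    rw [htop n le_rfl x₀ hx₀, finrank_top, Module.finrank_fin_fun] at h
    omega
  refine ⟨r, s, ⟨hr0, ?_, ?_⟩, ⟨hs0, ?_, ?_⟩, ?_, ?_, hsum⟩
  · have h := (hr (r - 1)).2 (by omega)
    rwa [Nat.sub_add_cancel hr0] at h
  · intro i hi h
    obtain ⟨j, rfl⟩ := Nat.exists_eq_add_of_le' hi
    exact (hr j).1 h
  · have h := (hs (s - 1)).2 (by omega)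
    rwa [Nat.sub_add_cancel hs0] at h
  · intro i hi h
    obtain ⟨j, rfl⟩ := Nat.exists_eq_add_of_le' hi
    exact (hs j).1 h
  · intro i hi h
    obtain ⟨j, rfl⟩ := Nat.exists_eq_add_of_le' hi
    exact hprop j h
  · intro i hi h
    obtain ⟨j, rfl⟩ := Nat.exists_eq_add_of_le' hi
    exact hprop' j h
end

section
/- Let Δ = (E,H,L) be a linear DACS with E, H ∈ ℝ^{l×n} and L ∈ ℝ^{l×m}. Define recursively the sets M₀ = ℝⁿ and M_{k+1} = {x ∈ M_k : Hx ∈ E(M_k) + Im L} (the geometric reduction sequence applied to Δ, using that the tangent space of a linear subspace is the subspace itself), and the augmented Wong sequence of subspaces 𝒱₀ = ℝⁿ, 𝒱_{i+1} = H⁻¹(E(𝒱_i) + Im L) (preimage under H). Then M_k = 𝒱_k for all k ≥ 0; in particular each M_k is a linear subspace of ℝⁿ. -/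
open Matrix Set

/-- The geometric reduction sequence applied to the linear DACS `Eẋ = Hx + Lu`:
`M₀ = ℝⁿ`, `M_{k+1} = {x ∈ M_k : Hx ∈ E(M_k) + Im L}`. -/
def Mseq {l n m : ℕ} (E H : Matrix (Fin l) (Fin n) ℝ) (L : Matrix (Fin l) (Fin m) ℝ) :
    ℕ → Set (Fin n → ℝ)
  | 0 => Set.univ
  | k + 1 => {x ∈ Mseq E H L k |
      ∃ w ∈ Mseq E H L k, ∃ u : Fin m → ℝ, H.mulVec x = E.mulVec w + L.mulVec u}

/-- The augmented Wong sequence `𝒱₀ = ℝⁿ`, `𝒱_{i+1} = H⁻¹(E(𝒱_i) + Im L)`. -/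
def Vseq {l n m : ℕ} (E H : Matrix (Fin l) (Fin n) ℝ) (L : Matrix (Fin l) (Fin m) ℝ) :
    ℕ → Submodule ℝ (Fin n → ℝ)
  | 0 => ⊤
  | i + 1 => Submodule.comap H.mulVecLin
      (Submodule.map E.mulVecLin (Vseq E H L i) ⊔ LinearMap.range L.mulVecLin)

theorem mem_Vseq_succ {l n m : ℕ} (E H : Matrix (Fin l) (Fin n) ℝ)
    (L : Matrix (Fin l) (Fin m) ℝ) (k : ℕ) (x : Fin n → ℝ) :
    x ∈ Vseq E H L (k + 1) ↔
      ∃ w ∈ Vseq E H L k, ∃ u : Fin m → ℝ, H.mulVec x = E.mulVec w + L.mulVec u := by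
  simp [Vseq, Submodule.mem_sup, eq_comm]

theorem Vseq_antitone {l n m : ℕ} (E H : Matrix (Fin l) (Fin n) ℝ)
    (L : Matrix (Fin l) (Fin m) ℝ) : Antitone (Vseq E H L) := by
  refine antitone_nat_of_succ_le fun k => ?_
  induction k with
  | zero => exact le_top
  | succ k ih => exact Submodule.comap_mono (sup_le_sup_right (Submodule.map_mono ih) _)

/-- For a linear DACS `Δ = (E,H,L)`, the geometric reduction sequence
coincides with the augmented Wong sequence: `M_k = 𝒱_k` for all `k ≥ 0`; in particular each
`M_k` is a linear subspace of `ℝⁿ`. -/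
theorem stmt_15 {l n m : ℕ} (E H : Matrix (Fin l) (Fin n) ℝ)
    (L : Matrix (Fin l) (Fin m) ℝ) :
    ∀ k : ℕ, Mseq E H L k = ↑(Vseq E H L k) := by
  intro k
  induction k with
  | zero => rfl
  | succ k ih =>
    ext x
    simp only [Mseq, ih, mem_ofPred_eq, SetLike.mem_coe, ← mem_Vseq_succ]
    exact and_iff_right_of_imp fun hx => Vseq_antitone E H L k.le_succ hx
end
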